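/- arXiv:1101.5901 — 3 statements merged into one kernel-verified Lean document; each statement's English description precedes it below -/
import Mathlib

section
/- Let n ≥ 2, let A = Mat_{n×n}(ℂ), and let r(v;y₁,y₂) be a unitary solution of the AYBE of the form (*). Then r̄₀(y₁,y₂) = (pr⊗pr)(r₀(y₁,y₂)) is a unitary solution of the classical Yang–Baxter equation (CYBE). -/
open Matrix Kronecker Filter Topology Set

noncomputable section

attribute [local instance] Matrix.normedAddCommGroup Matrix.normedSpace

abbrev Mat (n : ℕ) : Type := Matrix (Fin n) (Fin n) ℂ
abbrev T2 (n : ℕ) : Type := Matrix (Fin n × Fin n) (Fin n × Fin n) ℂ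
abbrev T3 (n : ℕ) : Type := Matrix (Fin n × Fin n × Fin n) (Fin n × Fin n × Fin n) ℂ

/-- The embedding `t ↦ t^{12}` of `A ⊗ A` into `A ⊗ A ⊗ A`. -/
def emb12 {n : ℕ} (t : T2 n) : T3 n :=
  Matrix.of fun p q => t (p.1, p.2.1) (q.1, q.2.1) * (if p.2.2 = q.2.2 then 1 else 0)

/-- The embedding `t ↦ t^{13}` of `A ⊗ A` into `A ⊗ A ⊗ A`. -/
def emb13 {n : ℕ} (t : T2 n) : T3 n :=
  Matrix.of fun p q => t (p.1, p.2.2) (q.1, q.2.2) * (if p.2.1 = q.2.1 then 1 else 0)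

/-- The embedding `t ↦ t^{23}` of `A ⊗ A` into `A ⊗ A ⊗ A`. -/
def emb23 {n : ℕ} (t : T2 n) : T3 n :=
  Matrix.of fun p q => t (p.2.1, p.2.2) (q.2.1, q.2.2) * (if p.1 = q.1 then 1 else 0)

/-- The flip `t ↦ t^{21}` on `A ⊗ A`. -/
def tflip {n : ℕ} (t : T2 n) : T2 n :=
  Matrix.of fun p q => t (p.2, p.1) (q.2, q.1)

/-- The associative Yang–Baxter equation with three spectral parameters. -/
def IsAYBESolution {n : ℕ} (r : ℂ → ℂ → ℂ → T2 n) : Prop :=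
  ∀ u v y₁ y₂ y₃ : ℂ, u ≠ 0 → v ≠ 0 → u + v ≠ 0 → y₁ ≠ y₂ → y₁ ≠ y₃ → y₂ ≠ y₃ →
    emb12 (r u y₁ y₂) * emb23 (r (u + v) y₂ y₃) =
      emb13 (r (u + v) y₁ y₃) * emb12 (r (-v) y₁ y₂) + emb23 (r v y₂ y₃) * emb13 (r u y₁ y₃)

/-- Unitarity: `r^{21}(-v; y₂, y₁) = - r(v; y₁, y₂)`. -/
def IsUnitarySolution {n : ℕ} (r : ℂ → ℂ → ℂ → T2 n) : Prop :=
  ∀ v y₁ y₂ : ℂ, v ≠ 0 → y₁ ≠ y₂ → tflip (r (-v) y₂ y₁) = - r v y₁ y₂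

/-- `can : A ⊗ A → End(A)`, `X ⊗ Y ↦ (Z ↦ tr(XZ)·Y)`. -/
def canMap {n : ℕ} (t : T2 n) (Z : Mat n) : Mat n :=
  Matrix.of fun k l => ∑ i, ∑ j, t (i, k) (j, l) * Z j i

/-- Non-degeneracy: on a dense subset of the domain the tensor is invertible under `can`. -/
def IsNonDegenerate {n : ℕ} (r : ℂ → ℂ → ℂ → T2 n) : Prop :=
  {p : ℂ × ℂ × ℂ | p.1 ≠ 0 ∧ p.2.1 ≠ p.2.2} ⊆
    closure {p : ℂ × ℂ × ℂ | p.1 ≠ 0 ∧ p.2.1 ≠ p.2.2 ∧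
      Function.Bijective (canMap (r p.1 p.2.1 p.2.2))}

/-- `r` is holomorphic on `{(v,y₁,y₂) : v ≠ 0, y₁ ≠ y₂}`. -/
def IsHolomorphicOnDomain {n : ℕ} (r : ℂ → ℂ → ℂ → T2 n) : Prop :=
  DifferentiableOn ℂ (fun p : ℂ × ℂ × ℂ => r p.1 p.2.1 p.2.2)
    {p : ℂ × ℂ × ℂ | p.1 ≠ 0 ∧ p.2.1 ≠ p.2.2}

/-- `r` is of the form (*): `r(v;y₁,y₂) = v⁻¹·1⊗1 + r₀(y₁,y₂) + v·r₁(y₁,y₂) + …`,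
with Taylor coefficients `rc k`. -/
def HasLaurentForm {n : ℕ} (r : ℂ → ℂ → ℂ → T2 n) (rc : ℕ → ℂ → ℂ → T2 n) : Prop :=
  ∀ y₁ y₂ : ℂ, y₁ ≠ y₂ → ∃ ε > 0, ∀ v : ℂ, v ≠ 0 → ‖v‖ < ε →
    HasSum (fun k : ℕ => v ^ k • rc k y₁ y₂) (r v y₁ y₂ - v⁻¹ • 1)

/-- `r` is meromorphic along the diagonal. -/
def IsMeromorphicAlongDiagonal {n : ℕ} (r : ℂ → ℂ → ℂ → T2 n) : Prop :=
  ∀ u : ℂ, u ≠ 0 → ∀ y₁ : ℂ, MeromorphicAt (fun y₂ => r u y₁ y₂) y₁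

/-- `pr ⊗ id` on `A ⊗ A`, where `pr X = X - (tr X / n)·1`. -/
def prLeft {n : ℕ} (t : T2 n) : T2 n :=
  Matrix.of fun p q => t p q - if p.1 = q.1 then (∑ m, t (m, p.2) (m, q.2)) / (n : ℂ) else 0

/-- `id ⊗ pr` on `A ⊗ A`. -/
def prRight {n : ℕ} (t : T2 n) : T2 n :=
  Matrix.of fun p q => t p q - if p.2 = q.2 then (∑ m, t (p.1, m) (q.1, m)) / (n : ℂ) else 0

/-- `pr ⊗ pr` on `A ⊗ A`. -/
def prTensorPr {n : ℕ} (t : T2 n) : T2 n := prLeft (prRight t)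

/-- `c` has no infinitesimal symmetries: the only traceless `a` with
`[c(y₁,y₂), a⊗1 + 1⊗a] = 0` for all `y₁ ≠ y₂` is `a = 0`. -/
def HasNoInfinitesimalSymmetry {n : ℕ} (c : ℂ → ℂ → T2 n) : Prop :=
  ∀ a : Mat n, a.trace = 0 →
    (∀ y₁ y₂ : ℂ, y₁ ≠ y₂ →
      c y₁ y₂ * (a ⊗ₖ (1 : Mat n) + (1 : Mat n) ⊗ₖ a) =
        (a ⊗ₖ (1 : Mat n) + (1 : Mat n) ⊗ₖ a) * c y₁ y₂) → a = 0

/-- The quantum Yang–Baxter equation. -/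
def SatisfiesQYBE {n : ℕ} (q : ℂ → ℂ → T2 n) : Prop :=
  ∀ y₁ y₂ y₃ : ℂ, y₁ ≠ y₂ → y₁ ≠ y₃ → y₂ ≠ y₃ →
    emb12 (q y₁ y₂) * emb13 (q y₁ y₃) * emb23 (q y₂ y₃) =
      emb23 (q y₂ y₃) * emb13 (q y₁ y₃) * emb12 (q y₁ y₂)

/-- The permutation tensor `P = Σ e_{ij} ⊗ e_{ji}`. -/
def Pmat (n : ℕ) : T2 n :=
  ∑ i : Fin n, ∑ j : Fin n,
    Matrix.single i j (1 : ℂ) ⊗ₖ Matrix.single j i (1 : ℂ)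

/-- The classical Yang–Baxter equation. -/
def IsCYBESolution {n : ℕ} (c : ℂ → ℂ → T2 n) : Prop :=
  ∀ y₁ y₂ y₃ : ℂ, y₁ ≠ y₂ → y₁ ≠ y₃ → y₂ ≠ y₃ →
    (emb12 (c y₁ y₂) * emb23 (c y₂ y₃) - emb23 (c y₂ y₃) * emb12 (c y₁ y₂)) +
      (emb12 (c y₁ y₂) * emb13 (c y₁ y₃) - emb13 (c y₁ y₃) * emb12 (c y₁ y₂)) +
      (emb13 (c y₁ y₃) * emb23 (c y₂ y₃) - emb23 (c y₂ y₃) * emb13 (c y₁ y₃)) = 0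

/-- Unitarity for solutions of the CYBE: `c^{21}(y₂,y₁) = -c(y₁,y₂)`. -/
def IsUnitaryCYBE {n : ℕ} (c : ℂ → ℂ → T2 n) : Prop :=
  ∀ y₁ y₂ : ℂ, y₁ ≠ y₂ → tflip (c y₂ y₁) = - c y₁ y₂


namespace RbarAux

variable {n : ℕ}

lemma emb12_add (x y : T2 n) : emb12 (x + y) = emb12 x + emb12 y := by
  ext p q; simp only [emb12, Matrix.add_apply, Matrix.of_apply, add_mul]
lemma emb13_add (x y : T2 n) : emb13 (x + y) = emb13 x + emb13 y := by
  ext p q; simp only [emb13, Matrix.add_apply, Matrix.of_apply, add_mul]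
lemma emb23_add (x y : T2 n) : emb23 (x + y) = emb23 x + emb23 y := by
  ext p q; simp only [emb23, Matrix.add_apply, Matrix.of_apply, add_mul]
lemma emb12_smul (c : ℂ) (x : T2 n) : emb12 (c • x) = c • emb12 x := by
  ext p q; simp [emb12]
lemma emb13_smul (c : ℂ) (x : T2 n) : emb13 (c • x) = c • emb13 x := by
  ext p q; simp [emb13]
lemma emb23_smul (c : ℂ) (x : T2 n) : emb23 (c • x) = c • emb23 x := by
  ext p q; simp [emb23]
lemma emb12_neg (x : T2 n) : emb12 (-x) = -emb12 x := by
  ext p q; simp only [emb12, Matrix.neg_apply, Matrix.of_apply, neg_mul]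
lemma emb13_neg (x : T2 n) : emb13 (-x) = -emb13 x := by
  ext p q; simp only [emb13, Matrix.neg_apply, Matrix.of_apply, neg_mul]
lemma emb23_neg (x : T2 n) : emb23 (-x) = -emb23 x := by
  ext p q; simp only [emb23, Matrix.neg_apply, Matrix.of_apply, neg_mul]
lemma emb12_one : emb12 (1 : T2 n) = 1 := by
  ext ⟨a, b, c⟩ ⟨a', b', c'⟩
  simp only [emb12, Matrix.one_apply, Matrix.of_apply, Prod.mk.injEq]; split_ifs <;> simp_all
lemma emb13_one : emb13 (1 : T2 n) = 1 := by
  ext ⟨a, b, c⟩ ⟨a', b', c'⟩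
  simp only [emb13, Matrix.one_apply, Matrix.of_apply, Prod.mk.injEq]; split_ifs <;> simp_all
lemma emb23_one : emb23 (1 : T2 n) = 1 := by
  ext ⟨a, b, c⟩ ⟨a', b', c'⟩
  simp only [emb23, Matrix.one_apply, Matrix.of_apply, Prod.mk.injEq]; split_ifs <;> simp_all
lemma emb12_cont : Continuous (emb12 : T2 n → T3 n) := by
  refine continuous_matrix fun p q => ?_
  simp only [emb12, Matrix.of_apply]
  exact (continuous_id.matrix_elem _ _).mul continuous_const
lemma emb13_cont : Continuous (emb13 : T2 n → T3 n) := by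
  refine continuous_matrix fun p q => ?_
  simp only [emb13, Matrix.of_apply]
  exact (continuous_id.matrix_elem _ _).mul continuous_const
lemma emb23_cont : Continuous (emb23 : T2 n → T3 n) := by
  refine continuous_matrix fun p q => ?_
  simp only [emb23, Matrix.of_apply]
  exact (continuous_id.matrix_elem _ _).mul continuous_const
lemma tflip_cont : Continuous (tflip : T2 n → T2 n) := by
  refine continuous_matrix fun p q => ?_
  simp only [tflip, Matrix.of_apply]
  exact (continuous_id.matrix_elem _ _)
lemma tflip_add (x y : T2 n) : tflip (x + y) = tflip x + tflip y := by
  ext p q; simp [tflip]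
lemma tflip_smul (c : ℂ) (x : T2 n) : tflip (c • x) = c • tflip x := by
  ext p q; simp [tflip]
lemma tflip_neg (x : T2 n) : tflip (-x) = -tflip x := by
  ext p q; simp [tflip]
lemma tflip_one : tflip (1 : T2 n) = 1 := by
  ext ⟨a, b⟩ ⟨a', b'⟩
  simp only [tflip, Matrix.one_apply, Matrix.of_apply, Prod.mk.injEq]; split_ifs <;> simp_all

/-- reversal of the three positions -/
def rev (n : ℕ) : (Fin n × Fin n × Fin n) ≃ (Fin n × Fin n × Fin n) where
  toFun p := (p.2.2, p.2.1, p.1)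
  invFun p := (p.2.2, p.2.1, p.1)
  left_inv _ := rfl
  right_inv _ := rfl

def sg (X : T3 n) : T3 n := X.submatrix (rev n) (rev n)

lemma sg_mul (X Y : T3 n) : sg (X * Y) = sg X * sg Y :=
  (Matrix.submatrix_mul_equiv X Y _ _ _).symm
lemma sg_add (X Y : T3 n) : sg (X + Y) = sg X + sg Y := rfl
lemma sg12 (x : T2 n) : sg (emb12 x) = emb23 (tflip x) := rfl
lemma sg13 (x : T2 n) : sg (emb13 x) = emb13 (tflip x) := rfl
lemma sg23 (x : T2 n) : sg (emb23 x) = emb12 (tflip x) := rfl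

lemma expansion {E : Type*} [NormedAddCommGroup E] [NormedSpace ℂ E]
    (c : ℕ → E) (F : ℂ → E) (ε : ℝ) (hε : 0 < ε)
    (h : ∀ v : ℂ, v ≠ 0 → ‖v‖ < ε → HasSum (fun k : ℕ => v ^ k • c k) (F v)) :
    Tendsto (fun v => v⁻¹ • (F v - c 0)) (𝓝[≠] 0) (𝓝 (c 1)) := by
  classical
  let p : FormalMultilinearSeries ℂ ℂ E := fun k => ContinuousMultilinearMap.mkPiRing ℂ (Fin k) (c k)
  have hc : ∀ k, p.coeff k = c k := by
    intro k; simp [p, FormalMultilinearSeries.coeff]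
  have hp : HasFPowerSeriesAt (Function.update F 0 (c 0)) p 0 := by
    rw [hasFPowerSeriesAt_iff]
    filter_upwards [Metric.ball_mem_nhds (0 : ℂ) hε] with z hz
    simp only [hc, zero_add]
    by_cases hz0 : z = 0
    · subst hz0
      rw [Function.update_self]
      have := hasSum_single (f := fun k : ℕ => (0 : ℂ) ^ k • c k) 0
        (fun k hk => by simp [hk])
      simpa using this
    · rw [Function.update_of_ne hz0]
      exact h z hz0 (by simpa using hz)
  have hd := hp.hasDerivAt
  rw [hasDerivAt_iff_tendsto_slope] at hd
  have e : (p 1) (fun _ => 1) = c 1 := hc 1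
  rw [e] at hd
  refine hd.congr' ?_
  filter_upwards [self_mem_nhdsWithin] with z hz
  simp [slope, Function.update_of_ne (show z ≠ 0 from hz)]

lemma expand (r : ℂ → ℂ → ℂ → T2 n) (rc : ℕ → ℂ → ℂ → T2 n) (hForm : HasLaurentForm r rc)
    (y₁ y₂ : ℂ) (h : y₁ ≠ y₂) :
    ∃ f : ℂ → T2 n, Tendsto f (𝓝[≠] 0) (𝓝 (rc 1 y₁ y₂)) ∧
      ∀ v, v ≠ 0 → r v y₁ y₂ = v⁻¹ • 1 + rc 0 y₁ y₂ + v • f v := by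
  obtain ⟨ε, hε, H⟩ := hForm y₁ y₂ h
  refine ⟨_, expansion (fun k => rc k y₁ y₂) (fun v => r v y₁ y₂ - v⁻¹ • 1) ε hε H, ?_⟩
  intro v hv
  rw [smul_smul, mul_inv_cancel₀ hv, one_smul]
  abel

lemma tends_mul {c : ℂ} (hc : c ≠ 0) : Tendsto (fun z : ℂ => c * z) (𝓝[≠] 0) (𝓝[≠] 0) := by
  refine tendsto_nhdsWithin_iff.2 ⟨?_, ?_⟩
  · have : Tendsto (fun z : ℂ => c * z) (𝓝 0) (𝓝 (c * 0)) := (continuous_const.mul continuous_id).tendsto _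
    rw [mul_zero] at this
    exact this.mono_left nhdsWithin_le_nhds
  · filter_upwards [self_mem_nhdsWithin] with z hz
    exact mul_ne_zero hc hz

lemma tends_id : Tendsto (fun z : ℂ => z) (𝓝[≠] 0) (𝓝 0) := tendsto_id.mono_left nhdsWithin_le_nhds

lemma unit_coeff (r : ℂ → ℂ → ℂ → T2 n) (rc : ℕ → ℂ → ℂ → T2 n)
    (hUnit : IsUnitarySolution r) (hForm : HasLaurentForm r rc)
    (y₁ y₂ : ℂ) (h : y₁ ≠ y₂) :
    tflip (rc 0 y₂ y₁) = - rc 0 y₁ y₂ ∧ tflip (rc 1 y₂ y₁) = rc 1 y₁ y₂ := by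
  obtain ⟨f, hf, ef⟩ := expand r rc hForm y₁ y₂ h
  obtain ⟨g, hg, eg⟩ := expand r rc hForm y₂ y₁ h.symm
  have hg' : Tendsto (fun z => tflip (g (-1 * z))) (𝓝[≠] 0) (𝓝 (tflip (rc 1 y₂ y₁))) :=
    (tflip_cont.tendsto _).comp (hg.comp (tends_mul (by norm_num)))
  have key : ∀ z : ℂ, z ≠ 0 →
      tflip (rc 0 y₂ y₁) + rc 0 y₁ y₂ = z • (tflip (g (-1 * z)) - f z) := by
    intro z hz
    have := hUnit z y₁ y₂ hz h
    rw [ef z hz, eg (-z) (neg_ne_zero.2 hz), tflip_add, tflip_add, tflip_smul, tflip_smul,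
      tflip_one, inv_neg] at this
    rw [neg_one_mul, smul_sub]
    linear_combination (norm := module) this
  have h0 : tflip (rc 0 y₂ y₁) + rc 0 y₁ y₂ = 0 := by
    have l := tends_id.smul (hg'.sub hf)
    rw [zero_smul] at l
    refine tendsto_nhds_unique ?_ l
    refine tendsto_const_nhds.congr' ?_
    filter_upwards [self_mem_nhdsWithin] with z hz using key z hz
  refine ⟨eq_neg_of_add_eq_zero_left h0, ?_⟩
  refine tendsto_nhds_unique hg' (hf.congr' ?_)
  filter_upwards [self_mem_nhdsWithin] with z hz
  have := key z hz
  rw [h0] at this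
  exact (sub_eq_zero.1 ((smul_eq_zero.1 this.symm).resolve_left hz)).symm

lemma order_zero (r : ℂ → ℂ → ℂ → T2 n) (rc : ℕ → ℂ → ℂ → T2 n)
    (hAYBE : IsAYBESolution r) (hForm : HasLaurentForm r rc)
    (y₁ y₂ y₃ : ℂ) (h12 : y₁ ≠ y₂) (h13 : y₁ ≠ y₃) (h23 : y₂ ≠ y₃) :
    emb12 (rc 0 y₁ y₂) * emb23 (rc 0 y₂ y₃) +
      (emb12 (rc 1 y₁ y₂) + emb13 (rc 1 y₁ y₃) + emb23 (rc 1 y₂ y₃)) =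
    emb13 (rc 0 y₁ y₃) * emb12 (rc 0 y₁ y₂) + emb23 (rc 0 y₂ y₃) * emb13 (rc 0 y₁ y₃) := by
  obtain ⟨f, hf, ef⟩ := expand r rc hForm y₁ y₂ h12
  obtain ⟨g, hg, eg⟩ := expand r rc hForm y₁ y₃ h13
  obtain ⟨k, hk, ek⟩ := expand r rc hForm y₂ y₃ h23
  have t2 : Tendsto (fun z : ℂ => 2 * z) (𝓝[≠] 0) (𝓝[≠] 0) := tends_mul (by norm_num)
  have tm : Tendsto (fun z : ℂ => -1 * z) (𝓝[≠] 0) (𝓝[≠] 0) := tends_mul (by norm_num)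
  have F := (emb12_cont.tendsto _).comp hf
  have Fm := F.comp tm
  have G := (emb13_cont.tendsto _).comp hg
  have G2 := G.comp t2
  have K := (emb23_cont.tendsto _).comp hk
  have K2 := K.comp t2
  set a := emb12 (rc 0 y₁ y₂)
  set b := emb13 (rc 0 y₁ y₃)
  set c := emb23 (rc 0 y₂ y₃)
  have za := fun (X : T3 n) => tendsto_const_nhds (x := X) (f := 𝓝[≠] (0:ℂ))
  have zc := fun (X : ℂ) => tendsto_const_nhds (x := X) (f := 𝓝[≠] (0:ℂ))
  have L := (((za (a * c)).add ((zc 2).smul K2)).add ((zc (1/2)).smul F)).add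
    (tends_id.smul ((((zc 2).smul ((za a).mul K2)).add (F.mul (za c))).add
      ((tends_id.smul ((zc 2).smul (F.mul K2))))))
  have R1 := (((za (b * a)).sub ((zc 2).smul G2)).sub ((zc (1/2)).smul Fm)).add
    (tends_id.smul ((((zc 2).smul (G2.mul (za a))).sub ((za b).mul Fm)).sub
      ((tends_id.smul ((zc 2).smul (G2.mul Fm))))))
  have R2 := (((za (c * b)).add K).add G).add
    (tends_id.smul (((K.mul (za b)).add ((za c).mul G)).add
      ((tends_id.smul (K.mul G)))))
  have key := tendsto_nhds_unique_of_eventuallyEq L (R1.add R2) ?_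
  · simp only [zero_smul, add_zero] at key
    have key' := congrArg (fun X => X) key
    clear_value a b c
    generalize emb12 (rc 1 y₁ y₂) = a1 at *
    generalize emb13 (rc 1 y₁ y₃) = b1 at *
    generalize emb23 (rc 1 y₂ y₃) = c1 at *
    clear L R1 R2
    linear_combination (norm := module) key
  · filter_upwards [self_mem_nhdsWithin] with z hz
    have hz : z ≠ 0 := hz
    have h2z : z + z ≠ 0 := by rw [← two_mul]; exact mul_ne_zero two_ne_zero hz
    have E := hAYBE z z y₁ y₂ y₃ hz hz h2z h12 h13 h23
    rw [ef z hz, ek _ h2z, eg _ h2z, ef _ (neg_ne_zero.2 hz), ek z hz, eg z hz] at E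
    simp only [emb12_add, emb13_add, emb23_add, emb12_smul, emb13_smul, emb23_smul,
      emb12_one, emb13_one, emb23_one] at E
    simp only [Function.comp, neg_one_mul]
    rw [← two_mul] at E
    change (z⁻¹ • 1 + a + _) * (_ + c + _) = (_ + b + _) * (_ + a + _) + (_ + c + _) * (_ + b + _) at E
    clear_value a b c
    generalize emb12 (f z) = f1 at *
    generalize emb12 (f (-z)) = f2 at *
    generalize emb13 (g z) = g1 at *
    generalize emb13 (g (2 * z)) = g2 at *
    generalize emb23 (k z) = k1 at *
    generalize emb23 (k (2 * z)) = k2 at *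
    have hi : z⁻¹ * z = 1 := inv_mul_cancel₀ hz
    have hi' : z * z⁻¹ = 1 := mul_inv_cancel₀ hz
    have h2i : (2 * z)⁻¹ = (1/2) * z⁻¹ := by rw [mul_inv]; norm_num
    rw [h2i] at E
    simp only [inv_neg] at E
    simp only [add_mul, mul_add, smul_mul_assoc, mul_smul_comm, one_mul, mul_one] at E ⊢
    linear_combination (norm := skip) E
    match_scalars <;> field_simp <;> ring

/-! partial traces -/

def tr1 (X : T3 n) : T3 n := Matrix.of fun p q =>
  if p.1 = q.1 then (∑ m, X (m, p.2) (m, q.2)) / (n : ℂ) else 0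
def tr2 (X : T3 n) : T3 n := Matrix.of fun p q =>
  if p.2.1 = q.2.1 then (∑ m, X (p.1, m, p.2.2) (q.1, m, q.2.2)) / (n : ℂ) else 0
def tr3 (X : T3 n) : T3 n := Matrix.of fun p q =>
  if p.2.2 = q.2.2 then (∑ m, X (p.1, p.2.1, m) (q.1, q.2.1, m)) / (n : ℂ) else 0

def D1 (x y : T2 n) : T3 n := emb12 x * emb23 y - emb23 y * emb12 x
def D2 (x y : T2 n) : T3 n := emb12 x * emb13 y - emb13 y * emb12 x
def D3 (x y : T2 n) : T3 n := emb13 x * emb23 y - emb23 y * emb13 x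


lemma D1_apply (x y : T2 n) (a b c a' b' c' : Fin n) : D1 x y (a, b, c) (a', b', c') =
    ∑ m, x (a, b) (a', m) * y (m, c) (b', c') - ∑ m, y (b, c) (m, c') * x (a, m) (a', b') := by
  simp [D1, emb12, emb23, Matrix.mul_apply, Fintype.sum_prod_type, Finset.sum_ite_eq, Finset.sum_ite_eq']
lemma D2_apply (x y : T2 n) (a b c a' b' c' : Fin n) : D2 x y (a, b, c) (a', b', c') =
    ∑ m, x (a, b) (m, b') * y (m, c) (a', c') - ∑ m, y (a, c) (m, c') * x (m, b) (a', b') := by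
  simp [D2, emb12, emb13, Matrix.mul_apply, Fintype.sum_prod_type, Finset.sum_ite_eq, Finset.sum_ite_eq']
lemma D3_apply (x y : T2 n) (a b c a' b' c' : Fin n) : D3 x y (a, b, c) (a', b', c') =
    ∑ m, x (a, c) (a', m) * y (b, m) (b', c') - ∑ m, y (b, c) (b', m) * x (a, m) (a', c') := by
  simp [D3, emb13, emb23, Matrix.mul_apply, Fintype.sum_prod_type, Finset.sum_ite_eq, Finset.sum_ite_eq']

lemma tr2_D1 (x y : T2 n) : tr2 (D1 x y) = 0 := by
  ext ⟨a, b, c⟩ ⟨a', b', c'⟩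
  simp only [tr2, Matrix.of_apply, D1_apply, Finset.sum_sub_distrib, Matrix.zero_apply]
  rw [Finset.sum_comm]
  simp [mul_comm]
lemma tr1_D2 (x y : T2 n) : tr1 (D2 x y) = 0 := by
  ext ⟨a, b, c⟩ ⟨a', b', c'⟩
  simp only [tr1, Matrix.of_apply, D2_apply, Finset.sum_sub_distrib, Matrix.zero_apply]
  rw [Finset.sum_comm]
  simp [mul_comm]
lemma tr3_D3 (x y : T2 n) : tr3 (D3 x y) = 0 := by
  ext ⟨a, b, c⟩ ⟨a', b', c'⟩
  simp only [tr3, Matrix.of_apply, D3_apply, Finset.sum_sub_distrib, Matrix.zero_apply]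
  rw [Finset.sum_comm]
  simp [mul_comm]

lemma D1_xR (x y : T2 n) : D1 (prRight x) y = D1 x y := by
  ext ⟨a, b, c⟩ ⟨a', b', c'⟩
  simp [D1_apply, prRight, sub_mul, mul_sub, Finset.sum_sub_distrib, mul_comm]
lemma D1_yL (x y : T2 n) : D1 x (prLeft y) = D1 x y := by
  ext ⟨a, b, c⟩ ⟨a', b', c'⟩
  simp [D1_apply, prLeft, sub_mul, mul_sub, Finset.sum_sub_distrib, mul_comm]
lemma D2_xL (x y : T2 n) : D2 (prLeft x) y = D2 x y := by
  ext ⟨a, b, c⟩ ⟨a', b', c'⟩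
  simp [D2_apply, prLeft, sub_mul, mul_sub, Finset.sum_sub_distrib, mul_comm]
lemma D2_yL (x y : T2 n) : D2 x (prLeft y) = D2 x y := by
  ext ⟨a, b, c⟩ ⟨a', b', c'⟩
  simp [D2_apply, prLeft, sub_mul, mul_sub, Finset.sum_sub_distrib, mul_comm]
lemma D3_xR (x y : T2 n) : D3 (prRight x) y = D3 x y := by
  ext ⟨a, b, c⟩ ⟨a', b', c'⟩
  simp [D3_apply, prRight, sub_mul, mul_sub, Finset.sum_sub_distrib, mul_comm]
lemma D3_yR (x y : T2 n) : D3 x (prRight y) = D3 x y := by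
  ext ⟨a, b, c⟩ ⟨a', b', c'⟩
  simp [D3_apply, prRight, sub_mul, mul_sub, Finset.sum_sub_distrib, mul_comm]

lemma aux1 (P : Prop) [Decidable P] (N : ℂ) (f g f' g' : Fin n → ℂ) (F G : Fin n → Fin n → ℂ) :
    ∑ m, (f m - if P then (∑ k, F k m) / N else 0) * g m
      - ∑ m, g' m * (f' m - if P then (∑ k, G k m) / N else 0) =
    (∑ m, f m * g m - ∑ m, g' m * f' m) -
      if P then (∑ k, (∑ m, F k m * g m - ∑ m, g' m * G k m)) / N else 0 := by
  split_ifs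
  · simp only [sub_mul, mul_sub, Finset.sum_sub_distrib, div_mul_eq_mul_div, mul_div_assoc',
      ← Finset.sum_div, Finset.sum_mul, Finset.mul_sum]
    rw [Finset.sum_comm (f := fun k m => F k m * g m), Finset.sum_comm (f := fun k m => g' m * G k m)]
    ring
  · simp

lemma aux2 (P : Prop) [Decidable P] (N : ℂ) (f g f' g' : Fin n → ℂ) (F G : Fin n → Fin n → ℂ) :
    ∑ m, g m * (f m - if P then (∑ k, F k m) / N else 0)
      - ∑ m, (f' m - if P then (∑ k, G k m) / N else 0) * g' m =
    (∑ m, g m * f m - ∑ m, f' m * g' m) -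
      if P then (∑ k, (∑ m, g m * F k m - ∑ m, G k m * g' m)) / N else 0 := by
  simp only [mul_comm (g _), mul_comm _ (g' _)]
  exact aux1 P N f g f' g' F G

lemma D1_xL (x y : T2 n) : D1 (prLeft x) y = D1 x y - tr1 (D1 x y) := by
  ext ⟨a, b, c⟩ ⟨a', b', c'⟩
  simp only [Matrix.sub_apply, D1_apply, prLeft, tr1, Matrix.of_apply]
  exact aux1 _ _ _ _ _ _ _ _
lemma D1_yR (x y : T2 n) : D1 x (prRight y) = D1 x y - tr3 (D1 x y) := by
  ext ⟨a, b, c⟩ ⟨a', b', c'⟩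
  simp only [Matrix.sub_apply, D1_apply, prRight, tr3, Matrix.of_apply]
  exact aux2 _ _ _ _ _ _ _ _
lemma D2_xR (x y : T2 n) : D2 (prRight x) y = D2 x y - tr2 (D2 x y) := by
  ext ⟨a, b, c⟩ ⟨a', b', c'⟩
  simp only [Matrix.sub_apply, D2_apply, prRight, tr2, Matrix.of_apply]
  exact aux1 _ _ _ _ _ _ _ _
lemma D2_yR (x y : T2 n) : D2 x (prRight y) = D2 x y - tr3 (D2 x y) := by
  ext ⟨a, b, c⟩ ⟨a', b', c'⟩
  simp only [Matrix.sub_apply, D2_apply, prRight, tr3, Matrix.of_apply]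
  exact aux2 _ _ _ _ _ _ _ _
lemma D3_xL (x y : T2 n) : D3 (prLeft x) y = D3 x y - tr1 (D3 x y) := by
  ext ⟨a, b, c⟩ ⟨a', b', c'⟩
  simp only [Matrix.sub_apply, D3_apply, prLeft, tr1, Matrix.of_apply]
  exact aux1 _ _ _ _ _ _ _ _
lemma D3_yL (x y : T2 n) : D3 x (prLeft y) = D3 x y - tr2 (D3 x y) := by
  ext ⟨a, b, c⟩ ⟨a', b', c'⟩
  simp only [Matrix.sub_apply, D3_apply, prLeft, tr2, Matrix.of_apply]
  exact aux2 _ _ _ _ _ _ _ _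

def P1 (X : T3 n) : T3 n := X - tr1 X
def P2 (X : T3 n) : T3 n := X - tr2 X
def P3 (X : T3 n) : T3 n := X - tr3 X

lemma P1_add (X Y : T3 n) : P1 (X + Y) = P1 X + P1 Y := by
  ext p q
  simp only [P1, tr1, Matrix.sub_apply, Matrix.add_apply, Matrix.of_apply, Finset.sum_add_distrib]
  split_ifs <;> ring
lemma P2_add (X Y : T3 n) : P2 (X + Y) = P2 X + P2 Y := by
  ext p q
  simp only [P2, tr2, Matrix.sub_apply, Matrix.add_apply, Matrix.of_apply, Finset.sum_add_distrib]
  split_ifs <;> ring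
lemma P3_add (X Y : T3 n) : P3 (X + Y) = P3 X + P3 Y := by
  ext p q
  simp only [P3, tr3, Matrix.sub_apply, Matrix.add_apply, Matrix.of_apply, Finset.sum_add_distrib]
  split_ifs <;> ring

def Q (X : T3 n) : T3 n := P1 (P2 (P3 X))

lemma Q_zero : Q (0 : T3 n) = 0 := by
  have h : Q ((0 : T3 n) + 0) = Q 0 + Q 0 := by simp only [Q, P1_add, P2_add, P3_add]
  simpa using h

lemma Q_D1 (x y : T2 n) : D1 (prTensorPr x) (prTensorPr y) = Q (D1 x y) := by
  have e3 : P3 (D1 x y) = D1 x (prRight y) := (D1_yR x y).symm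
  have e2 : P2 (D1 x (prRight y)) = D1 x (prRight y) := by rw [P2, tr2_D1, sub_zero]
  have e1 : P1 (D1 x (prRight y)) = D1 (prLeft x) (prRight y) := (D1_xL _ _).symm
  rw [Q, e3, e2, e1, prTensorPr, prTensorPr, D1_yL, D1_xL, D1_xR, ← D1_xL]
lemma Q_D2 (x y : T2 n) : D2 (prTensorPr x) (prTensorPr y) = Q (D2 x y) := by
  have e3 : P3 (D2 x y) = D2 x (prRight y) := (D2_yR x y).symm
  have e2 : P2 (D2 x (prRight y)) = D2 (prRight x) (prRight y) := (D2_xR _ _).symm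
  have e1 : P1 (D2 (prRight x) (prRight y)) = D2 (prRight x) (prRight y) := by
    rw [P1, tr1_D2, sub_zero]
  rw [Q, e3, e2, e1, prTensorPr, prTensorPr, D2_yL, D2_xL]
lemma Q_D3 (x y : T2 n) : D3 (prTensorPr x) (prTensorPr y) = Q (D3 x y) := by
  have e3 : P3 (D3 x y) = D3 x y := by rw [P3, tr3_D3, sub_zero]
  have e2 : P2 (D3 x y) = D3 x (prLeft y) := (D3_yL _ _).symm
  have e1 : P1 (D3 x (prLeft y)) = D3 (prLeft x) (prLeft y) := (D3_xL _ _).symm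
  rw [Q, e3, e2, e1, prTensorPr, prTensorPr, D3_xL, D3_xR, ← D3_xL, D3_yL, D3_yR, ← D3_yL]

lemma tflip_pr (x : T2 n) : tflip (prTensorPr x) = prTensorPr (tflip x) := by
  ext ⟨a, b⟩ ⟨a', b'⟩
  simp only [tflip, prTensorPr, prLeft, prRight, Matrix.of_apply, if_true, Finset.sum_sub_distrib]
  have h := Finset.sum_comm (s := Finset.univ) (t := Finset.univ)
    (f := fun i j : Fin n => x (i, j) (i, j))
  split_ifs <;> simp only [← Finset.sum_div, h, Finset.sum_const_zero] <;> ring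

lemma pr_neg (x : T2 n) : prTensorPr (-x) = -prTensorPr x := by
  ext ⟨a, b⟩ ⟨a', b'⟩
  simp only [prTensorPr, prLeft, prRight, Matrix.of_apply, Matrix.neg_apply, Finset.sum_neg_distrib,
    Finset.sum_sub_distrib]
  split_ifs <;> try simp only [neg_div, Finset.sum_neg_distrib, Finset.sum_const_zero]
  all_goals ring

lemma cybe0 (r : ℂ → ℂ → ℂ → T2 n) (rc : ℕ → ℂ → ℂ → T2 n)
    (hAYBE : IsAYBESolution r) (hUnit : IsUnitarySolution r) (hForm : HasLaurentForm r rc)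
    (y₁ y₂ y₃ : ℂ) (h12 : y₁ ≠ y₂) (h13 : y₁ ≠ y₃) (h23 : y₂ ≠ y₃) :
    D1 (rc 0 y₁ y₂) (rc 0 y₂ y₃) + D2 (rc 0 y₁ y₂) (rc 0 y₁ y₃) +
      D3 (rc 0 y₁ y₃) (rc 0 y₂ y₃) = 0 := by
  have A := order_zero r rc hAYBE hForm y₁ y₂ y₃ h12 h13 h23
  have B := congrArg sg (order_zero r rc hAYBE hForm y₃ y₂ y₁ h23.symm h13.symm h12.symm)
  obtain ⟨u12, w12⟩ := unit_coeff r rc hUnit hForm y₁ y₂ h12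
  obtain ⟨u13, w13⟩ := unit_coeff r rc hUnit hForm y₁ y₃ h13
  obtain ⟨u23, w23⟩ := unit_coeff r rc hUnit hForm y₂ y₃ h23
  simp only [sg_add, sg_mul, sg12, sg13, sg23, u12, u13, u23, w12, w13, w23, emb12_neg,
    emb13_neg, emb23_neg, neg_mul_neg] at B
  simp only [D1, D2, D3]
  linear_combination (norm := module) A - B

end RbarAux

/-- If `r` is a unitary solution of the AYBE of the form (*), then
`r̄₀ = (pr⊗pr)(r₀)` is a unitary solution of the CYBE. -/
theorem rbar_zero_unitary_cybe (n : ℕ) (hn : 2 ≤ n)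
    (r : ℂ → ℂ → ℂ → T2 n) (rc : ℕ → ℂ → ℂ → T2 n)
    (hAYBE : IsAYBESolution r) (hUnit : IsUnitarySolution r) (hForm : HasLaurentForm r rc) :
    IsCYBESolution (fun y₁ y₂ => prTensorPr (rc 0 y₁ y₂)) ∧
      IsUnitaryCYBE (fun y₁ y₂ => prTensorPr (rc 0 y₁ y₂)) := by
  refine ⟨fun y₁ y₂ y₃ h12 h13 h23 => ?_, fun y₁ y₂ h => ?_⟩
  · change RbarAux.D1 (prTensorPr _) (prTensorPr _) + RbarAux.D2 (prTensorPr _) (prTensorPr _) +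
      RbarAux.D3 (prTensorPr _) (prTensorPr _) = 0
    rw [RbarAux.Q_D1, RbarAux.Q_D2, RbarAux.Q_D3]
    have h := congrArg RbarAux.Q (RbarAux.cybe0 r rc hAYBE hUnit hForm y₁ y₂ y₃ h12 h13 h23)
    rw [RbarAux.Q_zero] at h
    rw [← h]
    simp only [RbarAux.Q, RbarAux.P1_add, RbarAux.P2_add, RbarAux.P3_add]
  · change tflip (prTensorPr _) = - prTensorPr _
    rw [RbarAux.tflip_pr, (RbarAux.unit_coeff r rc hUnit hForm y₁ y₂ h).1, RbarAux.pr_neg]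
end
end

section
/- Let n ≥ 2, let A = Mat_{n×n}(ℂ), and let r(v₁,v₂;y₁,y₂) be a unitary solution of the four-variable AYBE. Then r also satisfies the dual equation: r^{23}(v₂,v₃;y₂,y₃)·r^{12}(v₁,v₃;y₁,y₂) = r^{12}(v₁,v₂;y₁,y₂)·r^{13}(v₂,v₃;y₁,y₃) + r^{13}(v₁,v₃;y₁,y₃)·r^{23}(v₂,v₁;y₂,y₃), at all points where all six factors are defined. -/
open Matrix Kronecker Filter Topology Set

noncomputable section

attribute [local instance] Matrix.normedAddCommGroup Matrix.normedSpace

/-- The associative Yang–Baxter equation with four spectral parameters. -/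
def IsAYBE4Solution {n : ℕ} (r : ℂ → ℂ → ℂ → ℂ → T2 n) : Prop :=
  ∀ v₁ v₂ v₃ y₁ y₂ y₃ : ℂ, v₁ ≠ v₂ → v₁ ≠ v₃ → v₂ ≠ v₃ → y₁ ≠ y₂ → y₁ ≠ y₃ → y₂ ≠ y₃ →
    emb12 (r v₁ v₂ y₁ y₂) * emb23 (r v₁ v₃ y₂ y₃) =
      emb13 (r v₁ v₃ y₁ y₃) * emb12 (r v₃ v₂ y₁ y₂) + emb23 (r v₂ v₃ y₂ y₃) * emb13 (r v₁ v₂ y₁ y₃)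

/-- Unitarity for the four-variable AYBE: `r^{21}(v₂,v₁;y₂,y₁) = -r(v₁,v₂;y₁,y₂)`. -/
def IsUnitary4Solution {n : ℕ} (r : ℂ → ℂ → ℂ → ℂ → T2 n) : Prop :=
  ∀ v₁ v₂ y₁ y₂ : ℂ, v₁ ≠ v₂ → y₁ ≠ y₂ → tflip (r v₂ v₁ y₂ y₁) = - r v₁ v₂ y₁ y₂

/-- Reversal of the three tensor positions. -/
def rev3 (n : ℕ) : Fin n × Fin n × Fin n ≃ Fin n × Fin n × Fin n where
  toFun p := (p.2.2, p.2.1, p.1)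
  invFun p := (p.2.2, p.2.1, p.1)
  left_inv _ := rfl
  right_inv _ := rfl

theorem rev_emb12 {n : ℕ} (t : T2 n) :
    (emb12 t).submatrix (rev3 n) (rev3 n) = emb23 (tflip t) := rfl

theorem rev_emb23 {n : ℕ} (t : T2 n) :
    (emb23 t).submatrix (rev3 n) (rev3 n) = emb12 (tflip t) := rfl

theorem rev_emb13 {n : ℕ} (t : T2 n) :
    (emb13 t).submatrix (rev3 n) (rev3 n) = emb13 (tflip t) := rfl

theorem emb12_neg {n : ℕ} (t : T2 n) : emb12 (-t) = -emb12 t := by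
  ext p q; simp only [emb12, Matrix.of_apply, Matrix.neg_apply, neg_mul]

theorem emb13_neg {n : ℕ} (t : T2 n) : emb13 (-t) = -emb13 t := by
  ext p q; simp only [emb13, Matrix.of_apply, Matrix.neg_apply, neg_mul]

theorem emb23_neg {n : ℕ} (t : T2 n) : emb23 (-t) = -emb23 t := by
  ext p q; simp only [emb23, Matrix.of_apply, Matrix.neg_apply, neg_mul]

/-- A unitary solution of the four-variable AYBE satisfies the dual equation. -/
theorem dual_aybe_four_variables (n : ℕ) (hn : 2 ≤ n)
    (r : ℂ → ℂ → ℂ → ℂ → T2 n)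
    (hAYBE : IsAYBE4Solution r) (hUnit : IsUnitary4Solution r) :
    ∀ v₁ v₂ v₃ y₁ y₂ y₃ : ℂ, v₁ ≠ v₂ → v₁ ≠ v₃ → v₂ ≠ v₃ → y₁ ≠ y₂ → y₁ ≠ y₃ → y₂ ≠ y₃ →
      emb23 (r v₂ v₃ y₂ y₃) * emb12 (r v₁ v₃ y₁ y₂) =
        emb12 (r v₁ v₂ y₁ y₂) * emb13 (r v₂ v₃ y₁ y₃) +
          emb13 (r v₁ v₃ y₁ y₃) * emb23 (r v₂ v₁ y₂ y₃) := by
  intro v₁ v₂ v₃ y₁ y₂ y₃ h12 h13 h23 k12 k13 k23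
  have h := congrArg (fun M : T3 n => M.submatrix (rev3 n) (rev3 n))
    (hAYBE v₃ v₂ v₁ y₃ y₂ y₁ h23.symm h13.symm h12.symm k23.symm k13.symm k12.symm)
  simp only [Matrix.submatrix_add, Pi.add_apply,
    ← Matrix.submatrix_mul_equiv _ _ _ (rev3 n) _, rev_emb12, rev_emb13, rev_emb23] at h
  rw [hUnit v₂ v₃ y₂ y₃ h23 k23, hUnit v₁ v₃ y₁ y₂ h13 k12, hUnit v₁ v₃ y₁ y₃ h13 k13,
    hUnit v₂ v₁ y₂ y₃ h12.symm k23, hUnit v₁ v₂ y₁ y₂ h12 k12,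
    hUnit v₂ v₃ y₁ y₃ h23 k13] at h
  simp only [emb12_neg, emb13_neg, emb23_neg, neg_mul_neg] at h
  rw [h, add_comm]
end
end

section
/- Let n ≥ 2, let A = Mat_{n×n}(ℂ), and let r(v;y₁,y₂) and s(v;y₁,y₂) be unitary solutions of the AYBE of the form (*), with Taylor coefficients r_k and s_k at v = 0. If r₀ = s₀ and r₁ = s₁ on {y₁ ≠ y₂}, then r_k = s_k for all k ≥ 0; consequently, for each y₁ ≠ y₂ one has r(v;y₁,y₂) = s(v;y₁,y₂) for all nonzero v sufficiently close to 0. -/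
open Matrix Kronecker Filter Topology Set

noncomputable section

attribute [local instance] Matrix.normedAddCommGroup Matrix.normedSpace

theorem aybe_lim {E : Type*} [NormedAddCommGroup E] [NormedSpace ℂ E] (d : ℕ → E) (D : ℂ → E)
    (ε : ℝ) (hε : 0 < ε) (N : ℕ) (hd : ∀ k < N, d k = 0)
    (h : ∀ v : ℂ, v ≠ 0 → ‖v‖ < ε → HasSum (fun k : ℕ => v ^ k • d k) (D v)) :
    Tendsto (fun z : ℂ => (z ^ N)⁻¹ • D z) (𝓝[≠] 0) (𝓝 (d N)) := by
  classical
  let f : ℂ → E := fun z => if z = 0 then d N else (z ^ N)⁻¹ • D z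
  let p : FormalMultilinearSeries ℂ ℂ E :=
    fun k => ContinuousMultilinearMap.mkPiRing ℂ (Fin k) (d (k + N))
  have hc : ∀ k, p.coeff k = d (k + N) := by
    intro k
    simp [p, FormalMultilinearSeries.coeff]
  have hf : HasFPowerSeriesAt f p 0 := by
    rw [hasFPowerSeriesAt_iff]
    filter_upwards [Metric.ball_mem_nhds (0 : ℂ) hε] with z hz
    simp only [hc, zero_add]
    by_cases hz0 : z = 0
    · subst hz0
      have := hasSum_single (f := fun k : ℕ => (0 : ℂ) ^ k • d (k + N)) 0
        (fun k hk => by simp [hk])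
      simpa [f] using this
    · have h1 := h z hz0 (by simpa using hz)
      have h2 := (hasSum_nat_add_iff' N).2 h1
      rw [Finset.sum_eq_zero (fun k hk => by
        rw [hd k (Finset.mem_range.1 hk), smul_zero]), sub_zero] at h2
      have h3 := h2.const_smul (z ^ N)⁻¹
      simp only [f, hz0, if_false]
      convert h3 using 2 with k
      rw [smul_smul, pow_add]
      congr 1
      field_simp
  have hcont := hf.continuousAt
  have h0 : f 0 = d N := by simp [f]
  have := hcont.tendsto.mono_left (nhdsWithin_le_nhds (s := {0}ᶜ))
  rw [h0] at this
  refine this.congr' ?_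
  filter_upwards [self_mem_nhdsWithin] with z hz
  have : z ≠ 0 := hz
  simp [f, this]

theorem aybe_scale {E : Type*} [TopologicalSpace E] (f : ℂ → E) (l : E) (a : ℂ) (ha : a ≠ 0)
    (h : Tendsto f (𝓝[≠] 0) (𝓝 l)) :
    Tendsto (fun z : ℂ => f (a * z)) (𝓝[≠] 0) (𝓝 l) := by
  refine h.comp ?_
  refine tendsto_nhdsWithin_iff.2 ⟨?_, ?_⟩
  · have : Tendsto (fun z : ℂ => a * z) (𝓝 0) (𝓝 (a * 0)) :=
      (continuous_const_mul a).tendsto 0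
    rw [mul_zero] at this
    exact this.mono_left nhdsWithin_le_nhds
  · filter_upwards [self_mem_nhdsWithin] with z hz
    exact mul_ne_zero ha hz

theorem emb12_cont {n : ℕ} : Continuous (emb12 : T2 n → T3 n) := by
  refine continuous_pi fun p => continuous_pi fun q => ?_
  simp only [emb12, Matrix.of_apply]
  exact (continuous_id.matrix_elem (p.1, p.2.1) (q.1, q.2.1)).mul continuous_const

theorem emb13_cont {n : ℕ} : Continuous (emb13 : T2 n → T3 n) := by
  refine continuous_pi fun p => continuous_pi fun q => ?_
  simp only [emb13, Matrix.of_apply]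
  exact (continuous_id.matrix_elem (p.1, p.2.2) (q.1, q.2.2)).mul continuous_const

theorem emb23_cont {n : ℕ} : Continuous (emb23 : T2 n → T3 n) := by
  refine continuous_pi fun p => continuous_pi fun q => ?_
  simp only [emb23, Matrix.of_apply]
  exact (continuous_id.matrix_elem (p.2.1, p.2.2) (q.2.1, q.2.2)).mul continuous_const

theorem emb12_smul {n : ℕ} (c : ℂ) (t : T2 n) : emb12 (c • t) = c • emb12 t := by
  ext p q; simp [emb12]
theorem emb13_smul {n : ℕ} (c : ℂ) (t : T2 n) : emb13 (c • t) = c • emb13 t := by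
  ext p q; simp [emb13]
theorem emb23_smul {n : ℕ} (c : ℂ) (t : T2 n) : emb23 (c • t) = c • emb23 t := by
  ext p q; simp [emb23]
theorem emb12_sub {n : ℕ} (s t : T2 n) : emb12 (s - t) = emb12 s - emb12 t := by
  ext p q; simp only [emb12, Matrix.of_apply, Matrix.sub_apply, sub_mul]
theorem emb13_sub {n : ℕ} (s t : T2 n) : emb13 (s - t) = emb13 s - emb13 t := by
  ext p q; simp only [emb13, Matrix.of_apply, Matrix.sub_apply, sub_mul]
theorem emb23_sub {n : ℕ} (s t : T2 n) : emb23 (s - t) = emb23 s - emb23 t := by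
  ext p q; simp only [emb23, Matrix.of_apply, Matrix.sub_apply, sub_mul]
theorem emb12_one {n : ℕ} : emb12 (1 : T2 n) = 1 := by
  ext ⟨a, b, c⟩ ⟨a', b', c'⟩
  simp only [emb12, Matrix.of_apply, Matrix.one_apply, Prod.mk.injEq]
  split_ifs <;> simp_all
theorem emb13_one {n : ℕ} : emb13 (1 : T2 n) = 1 := by
  ext ⟨a, b, c⟩ ⟨a', b', c'⟩
  simp only [emb13, Matrix.of_apply, Matrix.one_apply, Prod.mk.injEq]
  split_ifs <;> simp_all
theorem emb23_one {n : ℕ} : emb23 (1 : T2 n) = 1 := by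
  ext ⟨a, b, c⟩ ⟨a', b', c'⟩
  simp only [emb23, Matrix.of_apply, Matrix.one_apply, Prod.mk.injEq]
  split_ifs <;> simp_all

/-- From `δ¹² = -δ¹³` for all distinct triples, `δ = 0`. -/
theorem aybe_even {n : ℕ} (d : ℂ → ℂ → T2 n)
    (h : ∀ y₁ y₂ y₃ : ℂ, y₁ ≠ y₂ → y₁ ≠ y₃ → y₂ ≠ y₃ →
      emb12 (d y₁ y₂) = - emb13 (d y₁ y₃)) (y₁ y₂ : ℂ) (hy : y₁ ≠ y₂) : d y₁ y₂ = 0 := by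
  obtain ⟨y₃, h3⟩ := (Set.toFinite ({y₁, y₂} : Set ℂ)).exists_notMem
  obtain ⟨y₄, h4⟩ := (Set.toFinite ({y₁, y₂, y₃} : Set ℂ)).exists_notMem
  simp only [Set.mem_insert_iff, Set.mem_singleton_iff, not_or] at h3 h4
  have e1 := h y₁ y₂ y₃ hy (Ne.symm h3.1) (Ne.symm h3.2)
  have e2 := h y₁ y₄ y₃ (Ne.symm h4.1) (Ne.symm h3.1) h4.2.2
  have e3 := h y₁ y₄ y₂ (Ne.symm h4.1) hy h4.2.1
  ext ⟨i, j⟩ ⟨i', j'⟩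
  have f1 := fun k k' => congrFun (congrFun e1 (i, j, k)) (i', j', k')
  have f2 := fun a b k k' => congrFun (congrFun e2 (i, a, k)) (i', b, k')
  have f3 := fun a b k k' => congrFun (congrFun e3 (i, a, k)) (i', b, k')
  simp only [emb12, emb13, Matrix.of_apply, Matrix.neg_apply] at f1 f2 f3
  by_cases hj : j = j'
  · subst hj
    have g1 := f1 j j
    have g2 := f2 j j j j
    have g3 := f3 j j j j
    simp only [if_true, mul_one] at g1 g2 g3
    simp only [Matrix.zero_apply]
    linear_combination (1/2 : ℂ) * (g1 - g2 + g3)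
  · have g1 := f1 j j
    simpa [hj] using g1

theorem aybe_limD {n : ℕ} {r s : ℂ → ℂ → ℂ → T2 n} {rc sc : ℕ → ℂ → ℂ → T2 n}
    (hr : HasLaurentForm r rc) (hs : HasLaurentForm s sc) (N : ℕ)
    (hN : ∀ k < N, ∀ y₁ y₂ : ℂ, y₁ ≠ y₂ → rc k y₁ y₂ = sc k y₁ y₂)
    (a : ℂ) (ha : a ≠ 0) (y₁ y₂ : ℂ) (hy : y₁ ≠ y₂) :
    Tendsto (fun z : ℂ => (z ^ N)⁻¹ • (r (a * z) y₁ y₂ - s (a * z) y₁ y₂)) (𝓝[≠] 0)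
      (𝓝 (a ^ N • (rc N y₁ y₂ - sc N y₁ y₂))) := by
  obtain ⟨ε₁, hε₁, h₁⟩ := hr y₁ y₂ hy
  obtain ⟨ε₂, hε₂, h₂⟩ := hs y₁ y₂ hy
  have key := aybe_lim (fun k => rc k y₁ y₂ - sc k y₁ y₂) (fun z => r z y₁ y₂ - s z y₁ y₂)
    (min ε₁ ε₂) (lt_min hε₁ hε₂) N (fun k hk => by simp [hN k hk y₁ y₂ hy])
    (fun v hv hv' => by
      have := (h₁ v hv (hv'.trans_le (min_le_left _ _))).sub
        (h₂ v hv (hv'.trans_le (min_le_right _ _)))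
      simp only [← smul_sub, sub_sub_sub_cancel_right] at this
      exact this)
  have k2 := (aybe_scale _ _ a ha key).const_smul (a ^ N)
  refine k2.congr fun z => ?_
  rw [smul_smul, mul_pow, mul_inv, mul_inv_cancel_left₀ (pow_ne_zero N ha)]

theorem aybe_limR {n : ℕ} {r : ℂ → ℂ → ℂ → T2 n} {rc : ℕ → ℂ → ℂ → T2 n}
    (hr : HasLaurentForm r rc) (a : ℂ) (ha : a ≠ 0) (y₁ y₂ : ℂ) (hy : y₁ ≠ y₂) :
    Tendsto (fun z : ℂ => z • r (a * z) y₁ y₂) (𝓝[≠] 0) (𝓝 (a⁻¹ • (1 : T2 n))) := by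
  obtain ⟨ε₁, hε₁, h₁⟩ := hr y₁ y₂ hy
  have key := aybe_lim (fun k => rc k y₁ y₂) (fun z => r z y₁ y₂ - z⁻¹ • 1)
    ε₁ hε₁ 0 (fun k hk => by omega) h₁
  have hz : Tendsto (fun z : ℂ => z) (𝓝[≠] 0) (𝓝 0) :=
    tendsto_id.mono_left nhdsWithin_le_nhds
  have k2 := (hz.smul (aybe_scale _ _ a ha key)).add_const (a⁻¹ • (1 : T2 n))
  rw [zero_smul, zero_add] at k2
  refine k2.congr' ?_
  filter_upwards [self_mem_nhdsWithin] with z hz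
  have hz : z ≠ 0 := hz
  rw [pow_zero, inv_one, one_smul, smul_sub, smul_smul, mul_inv, mul_comm a⁻¹,
    mul_inv_cancel_left₀ hz, sub_add_cancel]

theorem aybe_rel {n : ℕ} {r s : ℂ → ℂ → ℂ → T2 n} {rc sc : ℕ → ℂ → ℂ → T2 n}
    (hrA : IsAYBESolution r) (hsA : IsAYBESolution s)
    (hr : HasLaurentForm r rc) (hs : HasLaurentForm s sc) (N : ℕ)
    (hN : ∀ k < N, ∀ y₁ y₂ : ℂ, y₁ ≠ y₂ → rc k y₁ y₂ = sc k y₁ y₂)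
    (a b c m : ℂ) (ha : a ≠ 0) (hb : b ≠ 0) (hc : c ≠ 0) (hm : m ≠ 0) (hab : a + b = c)
    (hbm : -b = m)
    (y₁ y₂ y₃ : ℂ) (h12 : y₁ ≠ y₂) (h13 : y₁ ≠ y₃) (h23 : y₂ ≠ y₃) :
    (a ^ N * c⁻¹ - m ^ N * c⁻¹) • emb12 (rc N y₁ y₂ - sc N y₁ y₂)
      + (c ^ N * a⁻¹ - b ^ N * a⁻¹) • emb23 (rc N y₂ y₃ - sc N y₂ y₃)
      - (c ^ N * m⁻¹ + a ^ N * b⁻¹) • emb13 (rc N y₁ y₃ - sc N y₁ y₃) = 0 := by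
  have D := aybe_limD hr hs N hN
  have R := aybe_limR hr
  have S := aybe_limR hs
  have e12 : ∀ {f : ℂ → T2 n} {l}, Tendsto f (𝓝[≠] 0) (𝓝 l) →
      Tendsto (fun z => emb12 (f z)) (𝓝[≠] 0) (𝓝 (emb12 l)) :=
    fun h => (emb12_cont.tendsto _).comp h
  have e13 : ∀ {f : ℂ → T2 n} {l}, Tendsto f (𝓝[≠] 0) (𝓝 l) →
      Tendsto (fun z => emb13 (f z)) (𝓝[≠] 0) (𝓝 (emb13 l)) :=
    fun h => (emb13_cont.tendsto _).comp h
  have e23 : ∀ {f : ℂ → T2 n} {l}, Tendsto f (𝓝[≠] 0) (𝓝 l) →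
      Tendsto (fun z => emb23 (f z)) (𝓝[≠] 0) (𝓝 (emb23 l)) :=
    fun h => (emb23_cont.tendsto _).comp h
  have mulT : ∀ {f g : ℂ → T3 n} {k l}, Tendsto f (𝓝[≠] 0) (𝓝 k) → Tendsto g (𝓝[≠] 0) (𝓝 l) →
      Tendsto (fun z => f z * g z) (𝓝[≠] 0) (𝓝 (k * l)) := fun h1 h2 => h1.mul h2
  have t1 := mulT (e12 (D a ha y₁ y₂ h12)) (e23 (R c hc y₂ y₃ h23))
  have t2 := mulT (e12 (S a ha y₁ y₂ h12)) (e23 (D c hc y₂ y₃ h23))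
  have t3 := mulT (e13 (D c hc y₁ y₃ h13)) (e12 (R m hm y₁ y₂ h12))
  have t4 := mulT (e13 (S c hc y₁ y₃ h13)) (e12 (D m hm y₁ y₂ h12))
  have t5 := mulT (e23 (D b hb y₂ y₃ h23)) (e13 (R a ha y₁ y₃ h13))
  have t6 := mulT (e23 (S b hb y₂ y₃ h23)) (e13 (D a ha y₁ y₃ h13))
  have t := ((t1.add t2).sub (t3.add t4)).sub (t5.add t6)
  have t0 := t.congr' (f₂ := fun _ => (0 : T3 n)) (by
    filter_upwards [self_mem_nhdsWithin] with z hz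
    have hz : z ≠ 0 := hz
    have A1 := hrA (a * z) (b * z) y₁ y₂ y₃ (mul_ne_zero ha hz) (mul_ne_zero hb hz)
      (by rw [← add_mul, hab]; exact mul_ne_zero hc hz) h12 h13 h23
    have A2 := hsA (a * z) (b * z) y₁ y₂ y₃ (mul_ne_zero ha hz) (mul_ne_zero hb hz)
      (by rw [← add_mul, hab]; exact mul_ne_zero hc hz) h12 h13 h23
    rw [← add_mul, hab, ← neg_mul, hbm] at A1 A2
    simp only [emb12_smul, emb13_smul, emb23_smul, emb12_sub, emb13_sub, emb23_sub,
      smul_mul_smul_comm, mul_comm z, ← smul_add, ← smul_sub]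
    rw [smul_eq_zero]
    right
    rw [← sub_eq_zero] at A1 A2
    rw [← sub_self (0 : T3 n)]
    nth_rewrite 1 [← A1]
    rw [← A2]
    noncomm_ring)
  have t9 := tendsto_nhds_unique t0 tendsto_const_nhds
  simp only [emb12_smul, emb13_smul, emb23_smul, emb12_one, emb13_one, emb23_one,
      smul_mul_smul_comm, mul_one, one_mul] at t9
  rw [← t9]
  module

theorem aybe_step {n : ℕ} {r s : ℂ → ℂ → ℂ → T2 n} {rc sc : ℕ → ℂ → ℂ → T2 n}
    (hrA : IsAYBESolution r) (hsA : IsAYBESolution s)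
    (hr : HasLaurentForm r rc) (hs : HasLaurentForm s sc) (N : ℕ) (h2 : 2 ≤ N)
    (hN : ∀ k < N, ∀ y₁ y₂ : ℂ, y₁ ≠ y₂ → rc k y₁ y₂ = sc k y₁ y₂)
    (y₁ y₂ : ℂ) (hy : y₁ ≠ y₂) : rc N y₁ y₂ = sc N y₁ y₂ := by
  rw [← sub_eq_zero]
  refine aybe_even (fun y₁ y₂ => rc N y₁ y₂ - sc N y₁ y₂) ?_ y₁ y₂ hy
  clear hy y₁ y₂
  intro y₁ y₂ y₃ h12 h13 h23
  have E1 := aybe_rel hrA hsA hr hs N hN 1 1 2 (-1) (by norm_num) (by norm_num) (by norm_num)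
    (by norm_num) (by norm_num) (by norm_num) y₁ y₂ y₃ h12 h13 h23
  have E2 := aybe_rel hrA hsA hr hs N hN 1 (-2) (-1) 2 (by norm_num) (by norm_num) (by norm_num)
    (by norm_num) (by norm_num) (by norm_num) y₁ y₂ y₃ h12 h13 h23
  have E3 := aybe_rel hrA hsA hr hs N hN (-2) 1 (-1) (-1) (by norm_num) (by norm_num)
    (by norm_num) (by norm_num) (by norm_num) (by norm_num) y₁ y₂ y₃ h12 h13 h23
  have hK : (4 : ℝ) ≤ 2 ^ N := by
    calc (4 : ℝ) = 2 ^ 2 := by norm_num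
      _ ≤ 2 ^ N := pow_le_pow_right₀ (by norm_num) h2
  have hne : ∀ x : ℝ, x < 4 → (2 : ℂ) ^ N - (x : ℂ) ≠ 0 := by
    intro x hx h
    have : (((2 : ℝ) ^ N - x : ℝ) : ℂ) = 0 := by push_cast; exact h
    rw [Complex.ofReal_eq_zero] at this
    linarith
  have k1 : (2 : ℂ) ^ N - 1 ≠ 0 := by simpa using hne 1 (by norm_num)
  have k2 : (2 : ℂ) ^ N - 2 ≠ 0 := by simpa using hne 2 (by norm_num)
  have k3 : 2 * (2 : ℂ) ^ N - 1 ≠ 0 := by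
    have := hne (1/2) (by norm_num)
    intro h
    apply this
    push_cast
    linear_combination h / 2
  have hneg : (-2 : ℂ) ^ N = (-1) ^ N * 2 ^ N := by rw [← mul_pow]; norm_num
  rw [hneg] at E2 E3
  generalize (2 : ℂ) ^ N = K at *
  ext p q
  have F1 := congrFun (congrFun E1 p) q
  have F2 := congrFun (congrFun E2 p) q
  have F3 := congrFun (congrFun E3 p) q
  simp only [Matrix.add_apply, Matrix.sub_apply, Matrix.smul_apply, Matrix.zero_apply,
    Matrix.neg_apply, smul_eq_mul] at F1 F2 F3 ⊢
  generalize emb12 (rc N y₁ y₂ - sc N y₁ y₂) p q = x at *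
  generalize emb23 (rc N y₂ y₃ - sc N y₂ y₃) p q = y at *
  generalize emb13 (rc N y₁ y₃ - sc N y₁ y₃) p q = z at *
  rcases Nat.even_or_odd N with he | ho
  · rw [he.neg_one_pow, one_pow] at *
    refine mul_left_cancel₀ k1 ?_
    linear_combination F1 + F2
  · rw [ho.neg_one_pow, one_pow] at *
    refine mul_left_cancel₀ (mul_ne_zero k2 k3) ?_
    linear_combination 2 * (K - 1) * (F1 + F2 + F3) - (2 * K - 1) * (F1 + F2)

/-- A unitary solution of the AYBE of the form (*) is uniquely determined
by the Taylor coefficients `r₀` and `r₁`. -/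
theorem aybe_determined_by_r0_r1 (n : ℕ) (hn : 2 ≤ n)
    (r s : ℂ → ℂ → ℂ → T2 n) (rc sc : ℕ → ℂ → ℂ → T2 n)
    (hrAYBE : IsAYBESolution r) (hrUnit : IsUnitarySolution r) (hrForm : HasLaurentForm r rc)
    (hsAYBE : IsAYBESolution s) (hsUnit : IsUnitarySolution s) (hsForm : HasLaurentForm s sc)
    (h0 : ∀ y₁ y₂ : ℂ, y₁ ≠ y₂ → rc 0 y₁ y₂ = sc 0 y₁ y₂)
    (h1 : ∀ y₁ y₂ : ℂ, y₁ ≠ y₂ → rc 1 y₁ y₂ = sc 1 y₁ y₂) :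
    (∀ k : ℕ, ∀ y₁ y₂ : ℂ, y₁ ≠ y₂ → rc k y₁ y₂ = sc k y₁ y₂) ∧
      (∀ y₁ y₂ : ℂ, y₁ ≠ y₂ → ∃ ε > 0, ∀ v : ℂ, v ≠ 0 → ‖v‖ < ε →
        r v y₁ y₂ = s v y₁ y₂) := by
  have hall : ∀ k : ℕ, ∀ y₁ y₂ : ℂ, y₁ ≠ y₂ → rc k y₁ y₂ = sc k y₁ y₂ := by
    intro k
    induction k using Nat.strong_induction_on with
    | _ k ih =>
      intro y₁ y₂ hy
      by_cases hk0 : k = 0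
      · subst hk0; exact h0 y₁ y₂ hy
      by_cases hk1 : k = 1
      · subst hk1; exact h1 y₁ y₂ hy
      exact aybe_step hrAYBE hsAYBE hrForm hsForm k (by omega) ih y₁ y₂ hy
  refine ⟨hall, fun y₁ y₂ hy => ?_⟩
  obtain ⟨ε₁, hε₁, h₁⟩ := hrForm y₁ y₂ hy
  obtain ⟨ε₂, hε₂, h₂⟩ := hsForm y₁ y₂ hy
  refine ⟨min ε₁ ε₂, lt_min hε₁ hε₂, fun v hv hv' => ?_⟩
  have g1 := h₁ v hv (hv'.trans_le (min_le_left _ _))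
  have g2 := h₂ v hv (hv'.trans_le (min_le_right _ _))
  simp only [hall _ y₁ y₂ hy] at g1
  exact sub_left_injective (g1.unique g2)
end
end
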